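/- Let α ≥ 1 and 1 < k < ∞, and let m₀ ≥ 1. There exists a constant C > 0, depending only on m₀ and k, such that every nonnegative classical solution u of the one-dimensional nonlocal Fisher–KPP problem with initial mass ∫₀¹ u(0,x) dx = m₀ satisfies, for every t > 0, ∫₀¹ u(t,x)^k dx ≤ C + (C/t)^{k−1}. -/

import Mathlib

open Set Real MeasureTheory intervalIntegral

/-- A (global) classical solution of the one-dimensional nonlocal Fisher–KPP problem
`∂ₜu = ∂ₓₓu + u^α (1 - ∫₀¹ u dy)` on `Ω = (0,1)`, with Neumann boundary conditions.
`ut`, `ux`, `uxx` are the time derivative and the first and second spatial derivatives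
of `u`; they exist on `(0,∞) × [0,1]` and are jointly continuous there, while `u`
itself is continuous on `[0,∞) × [0,1]`. -/
def IsKPPSolution (α : ℝ) (u ut ux uxx : ℝ → ℝ → ℝ) : Prop :=
  ContinuousOn (fun p : ℝ × ℝ => u p.1 p.2) (Ici 0 ×ˢ Icc 0 1) ∧
  ContinuousOn (fun p : ℝ × ℝ => ut p.1 p.2) (Ioi 0 ×ˢ Icc 0 1) ∧
  ContinuousOn (fun p : ℝ × ℝ => ux p.1 p.2) (Ioi 0 ×ˢ Icc 0 1) ∧
  ContinuousOn (fun p : ℝ × ℝ => uxx p.1 p.2) (Ioi 0 ×ˢ Icc 0 1) ∧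
  (∀ t ∈ Ioi (0:ℝ), ∀ x ∈ Icc (0:ℝ) 1, HasDerivAt (fun s => u s x) (ut t x) t) ∧
  (∀ t ∈ Ioi (0:ℝ), ∀ x ∈ Icc (0:ℝ) 1,
    HasDerivWithinAt (fun y => u t y) (ux t x) (Icc 0 1) x) ∧
  (∀ t ∈ Ioi (0:ℝ), ∀ x ∈ Icc (0:ℝ) 1,
    HasDerivWithinAt (fun y => ux t y) (uxx t x) (Icc 0 1) x) ∧
  (∀ t ∈ Ioi (0:ℝ), ∀ x ∈ Icc (0:ℝ) 1,
    ut t x = uxx t x + u t x ^ α * (1 - ∫ y in (0:ℝ)..1, u t y)) ∧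
  (∀ t ∈ Ioi (0:ℝ), ux t 0 = 0 ∧ ux t 1 = 0)

/-- Nonnegativity of a solution on `[0,∞) × [0,1]`. -/
def KPPNonneg (u : ℝ → ℝ → ℝ) : Prop :=
  ∀ t ∈ Ici (0:ℝ), ∀ x ∈ Icc (0:ℝ) 1, 0 ≤ u t x

lemma kpp_slice {F : ℝ × ℝ → ℝ} {T : Set ℝ} (h : ContinuousOn F (T ×ˢ Icc 0 1)) {t : ℝ}
    (ht : t ∈ T) : ContinuousOn (fun x => F (t, x)) (Icc 0 1) :=
  h.comp (by fun_prop) (fun x hx => ⟨ht, hx⟩)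

lemma kpp_int {f : ℝ → ℝ} (h : ContinuousOn f (Icc 0 1)) :
    IntervalIntegrable f volume 0 1 :=
  ContinuousOn.intervalIntegrable_of_Icc zero_le_one h

lemma kpp_cont_integral {F : ℝ × ℝ → ℝ} (h : ContinuousOn F (Ici 0 ×ˢ Icc 0 1)) :
    ContinuousOn (fun t => ∫ x in (0:ℝ)..1, F (t, x)) (Ici 0) := by
  have hg : Continuous (fun p : ℝ × ℝ => F (max p.1 0, max 0 (min 1 p.2))) := by
    apply h.comp_continuous (by fun_prop)
    intro p
    refine ⟨mem_Ici.2 (le_max_right _ _), le_max_left _ _, ?_⟩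
    exact max_le zero_le_one (min_le_left _ _)
  have hc : Continuous (fun t : ℝ => ∫ x in (0:ℝ)..1, F (max t 0, max 0 (min 1 x))) :=
    intervalIntegral.continuous_parametric_intervalIntegral_of_continuous'
      (f := fun t x => F (max t 0, max 0 (min 1 x))) hg 0 1
  refine hc.continuousOn.congr ?_
  intro t ht
  apply intervalIntegral.integral_congr
  intro x hx
  rw [uIcc_of_le zero_le_one] at hx
  have h1 : max t 0 = t := max_eq_left ht
  have h2 : max 0 (min 1 x) = x := by rw [min_eq_right hx.2, max_eq_right hx.1]
  simp only [h1, h2]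

/-- Differentiation under the integral sign. -/
lemma kpp_deriv {α : ℝ} {u ut ux uxx : ℝ → ℝ → ℝ} (H : IsKPPSolution α u ut ux uxx)
    {φ φ' : ℝ → ℝ} (hφ : ∀ s, HasDerivAt φ (φ' s) s) (hφ' : Continuous φ') {t : ℝ} (ht : 0 < t) :
    HasDerivAt (fun s => ∫ x in (0:ℝ)..1, φ (u s x))
      (∫ x in (0:ℝ)..1, φ' (u t x) * ut t x) t := by
  obtain ⟨hu, hut, -, -, hdt, -⟩ := H
  have hφc : Continuous φ := continuous_iff_continuousAt.2 fun s => (hφ s).continuousAt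
  have hu' : ContinuousOn (fun p : ℝ × ℝ => u p.1 p.2) (Ioi 0 ×ˢ Icc 0 1) :=
    hu.mono (prod_mono_left Ioi_subset_Ici_self)
  have hG : ContinuousOn (fun p : ℝ × ℝ => φ' (u p.1 p.2) * ut p.1 p.2) (Ioi 0 ×ˢ Icc 0 1) :=
    (hφ'.comp_continuousOn hu').mul hut
  have hsub : Icc (t/2) (2*t) ⊆ Ioi 0 := fun s hs => lt_of_lt_of_le (by positivity) hs.1
  obtain ⟨B, hB⟩ := (isCompact_Icc.prod isCompact_Icc).exists_bound_of_continuousOn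
    (hG.mono (prod_mono_left (t := Icc (0:ℝ) 1) hsub))
  have hnhds : Icc (t/2) (2*t) ∈ nhds t := Icc_mem_nhds (by linarith) (by linarith)
  have hae : ∀ x : ℝ, x ∈ uIoc (0:ℝ) 1 → x ∈ Icc (0:ℝ) 1 := by
    intro x hx
    rw [uIoc_of_le zero_le_one] at hx
    exact ⟨hx.1.le, hx.2⟩
  refine (intervalIntegral.hasDerivAt_integral_of_dominated_loc_of_deriv_le
    (F := fun s x => φ (u s x)) (F' := fun s x => φ' (u s x) * ut s x)
    (bound := fun _ => B) hnhds ?_ ?_ ?_ ?_ ?_ ?_).2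
  · filter_upwards [hnhds] with s hs
    have := kpp_int (hφc.comp_continuousOn (kpp_slice hu' (hsub hs)))
    exact (intervalIntegrable_iff.1 this).aestronglyMeasurable
  · exact kpp_int (hφc.comp_continuousOn (kpp_slice hu' ht))
  · exact (intervalIntegrable_iff.1 (kpp_int (kpp_slice hG ht))).aestronglyMeasurable
  · exact Filter.Eventually.of_forall fun x hx s hs => hB (s, x) ⟨hs, hae x hx⟩
  · exact intervalIntegrable_const
  · exact Filter.Eventually.of_forall fun x hx s hs =>
      (hφ _).comp s (hdt s (hsub hs) x (hae x hx))

/-- Integration by parts. -/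
lemma kpp_parts {α : ℝ} {u ut ux uxx : ℝ → ℝ → ℝ} (H : IsKPPSolution α u ut ux uxx)
    {ψ ψ' : ℝ → ℝ} (hψ : ∀ s, HasDerivAt ψ (ψ' s) s) (hψ' : Continuous ψ') {t : ℝ} (ht : 0 < t) :
    ∫ x in (0:ℝ)..1, ψ (u t x) * uxx t x = - ∫ x in (0:ℝ)..1, ψ' (u t x) * ux t x ^ 2 := by
  obtain ⟨hu, -, hux, huxx, -, hdx, hdxx, -, hN⟩ := H
  have hψc : Continuous ψ := continuous_iff_continuousAt.2 fun s => (hψ s).continuousAt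
  have c0 := kpp_slice hu (mem_Ici.2 ht.le)
  have c1 := kpp_slice hux (mem_Ioi.2 ht)
  have c2 := kpp_slice huxx (mem_Ioi.2 ht)
  simp only at c0 c1 c2
  have i1 : ContinuousOn (fun x => ψ (u t x) * uxx t x) (Icc 0 1) :=
    (hψc.comp_continuousOn c0).mul c2
  have i2 : ContinuousOn (fun x => ψ' (u t x) * ux t x ^ 2) (Icc 0 1) :=
    (hψ'.comp_continuousOn c0).mul (c1.pow 2)
  have key : ∫ x in (0:ℝ)..1, (ψ (u t x) * uxx t x + ψ' (u t x) * ux t x ^ 2)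
      = ψ (u t 1) * ux t 1 - ψ (u t 0) * ux t 0 := by
    refine intervalIntegral.integral_eq_sub_of_hasDerivAt_of_le (f := fun x => ψ (u t x) * ux t x)
      zero_le_one ((hψc.comp_continuousOn c0).mul c1) ?_ ((kpp_int i1).add (kpp_int i2))
    intro x hx
    have hn : Icc (0:ℝ) 1 ∈ nhds x := Icc_mem_nhds hx.1 hx.2
    have hx' : x ∈ Icc (0:ℝ) 1 := Ioo_subset_Icc_self hx
    have d1 := (hdx t ht x hx').hasDerivAt hn
    have d2 := (hdxx t ht x hx').hasDerivAt hn
    have := ((hψ (u t x)).comp x d1).mul d2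
    refine this.congr_deriv ?_
    simp only [Function.comp]
    ring
  rw [intervalIntegral.integral_add (kpp_int i1) (kpp_int i2), (hN t ht).1, (hN t ht).2] at key
  linarith

/-- Energy identity. -/
lemma kpp_energy_eq {α : ℝ} (hα : 1 ≤ α) {u ut ux uxx : ℝ → ℝ → ℝ}
    (H : IsKPPSolution α u ut ux uxx)
    {φ φ' φ'' : ℝ → ℝ} (hφ : ∀ s, HasDerivAt φ (φ' s) s) (hφ' : ∀ s, HasDerivAt φ' (φ'' s) s)
    (hφ'' : Continuous φ'') {t : ℝ} (ht : 0 < t) :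
    HasDerivAt (fun s => ∫ x in (0:ℝ)..1, φ (u s x))
      (- (∫ x in (0:ℝ)..1, φ'' (u t x) * ux t x ^ 2)
        + (1 - ∫ y in (0:ℝ)..1, u t y) * ∫ x in (0:ℝ)..1, φ' (u t x) * u t x ^ α) t := by
  have hc : Continuous φ' := continuous_iff_continuousAt.2 fun s => (hφ' s).continuousAt
  refine (kpp_deriv H hφ hc ht).congr_deriv ?_
  rw [← kpp_parts H hφ' hφ'' ht]
  obtain ⟨hu, -, hux, huxx, -, hdx, hdxx, hpde, hN⟩ := H
  have c0 := kpp_slice hu (mem_Ici.2 ht.le)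
  have c2 := kpp_slice huxx (mem_Ioi.2 ht)
  simp only at c0 c2
  have i1 : ContinuousOn (fun x => φ' (u t x) * uxx t x) (Icc 0 1) :=
    (hc.comp_continuousOn c0).mul c2
  have i2 : ContinuousOn (fun x => φ' (u t x) * u t x ^ α) (Icc 0 1) :=
    (hc.comp_continuousOn c0).mul (c0.rpow_const fun x _ => Or.inr (by linarith))
  rw [← intervalIntegral.integral_const_mul,
    ← intervalIntegral.integral_add (kpp_int i1) ((kpp_int i2).const_mul _)]
  apply intervalIntegral.integral_congr
  intro x hx
  rw [uIcc_of_le zero_le_one] at hx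
  simp only [hpde t ht x hx]
  ring

lemma kpp_pos2 (s : ℝ) : HasDerivAt (fun s : ℝ => max s 0 ^ 2) (2 * max s 0) s := by
  rcases lt_trichotomy s 0 with h | h | h
  · have : HasDerivAt (fun _ : ℝ => (0:ℝ)) 0 s := hasDerivAt_const _ _
    rw [max_eq_right h.le, mul_zero]
    refine this.congr_of_eventuallyEq ?_
    filter_upwards [Iio_mem_nhds h] with y hy
    simp [max_eq_right (le_of_lt (mem_Iio.1 hy))]
  · subst h
    rw [hasDerivAt_iff_isLittleO]
    simp only [max_self, sub_zero, mul_zero, smul_zero]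
    rw [Asymptotics.isLittleO_iff]
    intro c hc
    filter_upwards [Metric.ball_mem_nhds (0:ℝ) hc] with y hy
    rw [Metric.mem_ball, dist_zero_right] at hy
    have h1 : |max y 0| ≤ |y| := by
      rcases le_total y 0 with h | h
      · simp [max_eq_right h]
      · simp [max_eq_left h]
    simp only [Real.norm_eq_abs] at hy ⊢
    rw [show max y 0 ^ 2 - (0:ℝ)^2 = max y 0 ^ 2 by ring, abs_pow]
    nlinarith [abs_nonneg y, abs_nonneg (max y 0)]
  · rw [max_eq_left h.le]
    have := hasDerivAt_pow 2 s
    simp only [Nat.cast_ofNat, Nat.add_one_sub_one, pow_one] at this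
    refine this.congr_of_eventuallyEq ?_
    filter_upwards [Ioi_mem_nhds h] with y hy
    simp [max_eq_left (le_of_lt (mem_Ioi.1 hy))]

lemma kpp_pos3 (s : ℝ) : HasDerivAt (fun s : ℝ => max s 0 ^ 3) (3 * max s 0 ^ 2) s := by
  have h : (fun s : ℝ => max s 0 ^ 3) = fun s => s * max s 0 ^ 2 := by
    funext s
    rcases le_total s 0 with h | h
    · simp [max_eq_right h]
    · rw [max_eq_left h]; ring
  rw [h]
  refine ((hasDerivAt_id s).mul (kpp_pos2 s)).congr_deriv ?_
  rcases le_total s 0 with h | h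
  · simp [max_eq_right h]
  · simp only [max_eq_left h, id]; ring

/-- The mass stays in `[1, m₀]`. -/
lemma kpp_mass {α : ℝ} (hα : 1 ≤ α) {u ut ux uxx : ℝ → ℝ → ℝ}
    (H : IsKPPSolution α u ut ux uxx) (hn : KPPNonneg u) {m₀ : ℝ} (hm : 1 ≤ m₀)
    (h0 : ∫ x in (0:ℝ)..1, u 0 x = m₀) {t : ℝ} (ht : 0 < t) :
    1 ≤ ∫ x in (0:ℝ)..1, u t x ∧ ∫ x in (0:ℝ)..1, u t x ≤ m₀ := by
  have hcont : ContinuousOn (fun t => ∫ x in (0:ℝ)..1, u t x) (Ici 0) := kpp_cont_integral H.1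
  have hder : ∀ s, 0 < s → HasDerivAt (fun s => ∫ x in (0:ℝ)..1, u s x)
      ((1 - ∫ y in (0:ℝ)..1, u s y) * ∫ x in (0:ℝ)..1, u s x ^ α) s := by
    intro s hs
    have := kpp_energy_eq hα H (φ := fun s => s) (φ' := fun _ => 1) (φ'' := fun _ => 0)
      (fun s => hasDerivAt_id s) (fun s => hasDerivAt_const _ _) continuous_const hs
    simpa using this
  have ha : ∀ s, 0 < s → 0 ≤ ∫ x in (0:ℝ)..1, u s x ^ α := fun s hs =>
    intervalIntegral.integral_nonneg zero_le_one fun x hx => rpow_nonneg (hn s hs.le x hx) _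
  set m : ℝ → ℝ := fun t => ∫ x in (0:ℝ)..1, u t x with hmdef
  have hge : ∀ s, 0 < s → 1 ≤ m s := by
    have hanti : AntitoneOn (fun s => max (1 - m s) 0 ^ 2) (Ici 0) := by
      refine antitoneOn_of_hasDerivWithinAt_nonpos (convex_Ici 0)
        (f' := fun s => 2 * max (1 - m s) 0 * (-((1 - m s) * ∫ x in (0:ℝ)..1, u s x ^ α))) ?_ ?_ ?_
      · have : Continuous fun r : ℝ => max (1 - r) 0 ^ 2 := by fun_prop
        exact this.comp_continuousOn hcont
      · intro s hs
        rw [interior_Ici] at hs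
        exact ((kpp_pos2 _).comp s ((hder s hs).const_sub 1)).hasDerivWithinAt
      · intro s hs
        rw [interior_Ici] at hs
        rcases le_total (1 - m s) 0 with h | h
        · simp [max_eq_right h]
        · have := ha s hs
          rw [max_eq_left h]
          nlinarith [mul_nonneg (mul_self_nonneg (1 - m s)) this]
    intro s hs
    have h1 := hanti self_mem_Ici (mem_Ici.2 hs.le) hs.le
    have h2 : max (1 - m 0) 0 = 0 := max_eq_right (by simp only [hmdef, h0]; linarith)
    simp only [h2] at h1
    have h3 : max (1 - m s) 0 = 0 := by
      have : max (1 - m s) 0 ^ 2 = 0 := le_antisymm (by simpa using h1) (sq_nonneg _)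
      exact pow_eq_zero_iff (two_ne_zero) |>.1 this
    have := max_eq_right_iff.1 h3
    linarith
  refine ⟨hge t ht, ?_⟩
  have hanti : AntitoneOn m (Ici 0) := by
    refine antitoneOn_of_hasDerivWithinAt_nonpos (convex_Ici 0)
      (f' := fun s => (1 - m s) * ∫ x in (0:ℝ)..1, u s x ^ α) hcont ?_ ?_
    · intro s hs
      rw [interior_Ici] at hs
      exact (hder s hs).hasDerivWithinAt
    · intro s hs
      rw [interior_Ici] at hs
      exact mul_nonpos_of_nonpos_of_nonneg (by linarith [hge s hs]) (ha s hs)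
  have := hanti self_mem_Ici (mem_Ici.2 ht.le) ht.le
  rw [← h0]
  exact this

/-- One-dimensional Sobolev bound. -/
lemma kpp_sobolev {f f' : ℝ → ℝ} (hd : ∀ x ∈ Icc (0:ℝ) 1, HasDerivWithinAt f (f' x) (Icc 0 1) x)
    (hc : ContinuousOn f' (Icc 0 1)) {x : ℝ} (hx : x ∈ Icc (0:ℝ) 1) :
    f x ≤ (∫ y in (0:ℝ)..1, f y) + √(∫ y in (0:ℝ)..1, f' y ^ 2) := by
  have hfc : ContinuousOn f (Icc 0 1) := fun y hy => (hd y hy).continuousWithinAt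
  obtain ⟨z, hz, hmin⟩ := isCompact_Icc.exists_isMinOn ⟨(0:ℝ), by simp⟩ hfc
  have h1 : f z ≤ ∫ y in (0:ℝ)..1, f y := by
    have := intervalIntegral.integral_mono_on (a := (0:ℝ)) (b := 1) zero_le_one
      (intervalIntegrable_const (c := f z)) (kpp_int hfc) (fun y hy => hmin hy)
    simpa using this
  have hsub : uIcc z x ⊆ Icc 0 1 := by
    rw [← uIcc_of_le zero_le_one] at hz hx ⊢
    exact uIcc_subset_uIcc hz hx
  have h2 : ∫ y in z..x, f' y = f x - f z := by
    refine intervalIntegral.integral_eq_sub_of_hasDeriv_right (hfc.mono hsub) ?_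
      (hc.mono hsub).intervalIntegrable
    intro y hy
    have hy1 : y ∈ Icc (0:ℝ) 1 := hsub (Ioo_subset_Icc_self hy)
    have hy2 : y ∈ Ioo (0:ℝ) 1 :=
      ⟨lt_of_le_of_lt (le_min hz.1 hx.1) hy.1, lt_of_lt_of_le hy.2 (max_le hz.2 hx.2)⟩
    exact ((hd y hy1).hasDerivAt (Icc_mem_nhds hy2.1 hy2.2)).hasDerivWithinAt
  have habs : ContinuousOn (fun y => |f' y|) (Icc 0 1) := hc.abs
  have h3 : f x - f z ≤ ∫ y in (0:ℝ)..1, |f' y| := by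
    rw [← h2]
    have e1 := intervalIntegral.norm_integral_le_abs_integral_norm (f := f') (a := z) (b := x)
      (μ := volume)
    have e2 : |∫ y in z..x, ‖f' y‖| ≤ |∫ y in (0:ℝ)..1, ‖f' y‖| := by
      refine intervalIntegral.abs_integral_mono_interval ?_ ?_ (kpp_int habs)
      · rw [← uIcc_of_le zero_le_one] at hz hx
        exact uIoc_subset_uIoc_of_uIcc_subset_uIcc (uIcc_subset_uIcc hz hx)
      · exact Filter.Eventually.of_forall fun y => norm_nonneg _
    rw [abs_of_nonneg (a := ∫ y in (0:ℝ)..1, ‖f' y‖)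
      (intervalIntegral.integral_nonneg zero_le_one fun y _ => norm_nonneg _)] at e2
    simp only [Real.norm_eq_abs] at e1 e2
    linarith [le_abs_self (∫ y in z..x, f' y)]
  set c := ∫ y in (0:ℝ)..1, |f' y| with hcdef
  have h4 : c ^ 2 ≤ ∫ y in (0:ℝ)..1, f' y ^ 2 := by
    have hh : 0 ≤ ∫ y in (0:ℝ)..1, (|f' y| - c) ^ 2 :=
      intervalIntegral.integral_nonneg zero_le_one fun y _ => sq_nonneg _
    have : ∫ y in (0:ℝ)..1, (|f' y| - c) ^ 2
        = (∫ y in (0:ℝ)..1, f' y ^ 2) - c ^ 2 := by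
      have e : ∀ y, (|f' y| - c) ^ 2 = f' y ^ 2 - 2 * c * |f' y| + c ^ 2 := by
        intro y
        rw [← sq_abs (f' y)]
        ring
      have hsq : ContinuousOn (fun y => f' y ^ 2) (Icc 0 1) := hc.pow 2
      simp only [e]
      rw [intervalIntegral.integral_add
        ((kpp_int hsq).sub ((kpp_int habs).const_mul _)) intervalIntegrable_const,
        intervalIntegral.integral_sub (kpp_int hsq) ((kpp_int habs).const_mul _),
        intervalIntegral.integral_const_mul, ← hcdef]
      simp
      ring
    linarith
  have h5 := Real.le_sqrt_of_sq_le h4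
  linarith

/-- Dissipation inequality. -/
lemma kpp_energy {α : ℝ} (hα : 1 ≤ α) {u ut ux uxx : ℝ → ℝ → ℝ}
    (H : IsKPPSolution α u ut ux uxx) (hn : KPPNonneg u) {m₀ : ℝ} (hm : 1 ≤ m₀)
    (h0 : ∫ x in (0:ℝ)..1, u 0 x = m₀)
    {φ φ' φ'' : ℝ → ℝ} (hφ : ∀ s, HasDerivAt φ (φ' s) s) (hφ' : ∀ s, HasDerivAt φ' (φ'' s) s)
    (hφ'' : Continuous φ'') (hpos : ∀ s, 0 ≤ s → 0 ≤ φ' s) {t : ℝ} (ht : 0 < t) :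
    ∃ d, HasDerivAt (fun s => ∫ x in (0:ℝ)..1, φ (u s x)) d t ∧
      d ≤ - ∫ x in (0:ℝ)..1, φ'' (u t x) * ux t x ^ 2 := by
  refine ⟨_, kpp_energy_eq hα H hφ hφ' hφ'' ht, ?_⟩
  have h1 := (kpp_mass hα H hn hm h0 ht).1
  have h2 : 0 ≤ ∫ x in (0:ℝ)..1, φ' (u t x) * u t x ^ α :=
    intervalIntegral.integral_nonneg zero_le_one fun x hx =>
      mul_nonneg (hpos _ (hn t ht.le x hx)) (rpow_nonneg (hn t ht.le x hx) _)
  nlinarith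

/-- The supremum does not increase. -/
lemma kpp_max {α : ℝ} (hα : 1 ≤ α) {u ut ux uxx : ℝ → ℝ → ℝ}
    (H : IsKPPSolution α u ut ux uxx) (hn : KPPNonneg u) {m₀ : ℝ} (hm : 1 ≤ m₀)
    (h0 : ∫ x in (0:ℝ)..1, u 0 x = m₀) {s t M : ℝ} (hs : 0 < s) (hst : s ≤ t)
    (hM : ∀ x ∈ Icc (0:ℝ) 1, u s x ≤ M) : ∀ x ∈ Icc (0:ℝ) 1, u t x ≤ M := by
  have hφ : ∀ r : ℝ, HasDerivAt (fun r : ℝ => max (r - M) 0 ^ 3) (3 * max (r - M) 0 ^ 2) r := by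
    intro r
    have := (kpp_pos3 (r - M)).comp r ((hasDerivAt_id r).sub_const M)
    simpa [Function.comp_def] using this
  have hφ' : ∀ r : ℝ, HasDerivAt (fun r : ℝ => 3 * max (r - M) 0 ^ 2)
      (6 * max (r - M) 0) r := by
    intro r
    have := ((kpp_pos2 (r - M)).comp r ((hasDerivAt_id r).sub_const M)).const_mul 3
    refine this.congr_deriv ?_
    ring
  have hE : ∀ r, 0 < r → ∃ d, HasDerivAt (fun s => ∫ x in (0:ℝ)..1, max (u s x - M) 0 ^ 3) d r ∧
      d ≤ 0 := by
    intro r hr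
    obtain ⟨d, hd, hd'⟩ := kpp_energy hα H hn hm h0 hφ hφ' (by fun_prop)
      (fun r _ => by positivity) hr
    refine ⟨d, hd, hd'.trans ?_⟩
    rw [neg_nonpos]
    exact intervalIntegral.integral_nonneg zero_le_one fun x _ =>
      mul_nonneg (mul_nonneg (by norm_num) (le_max_right _ _)) (sq_nonneg _)
  choose! d hd hd' using hE
  have hanti : AntitoneOn (fun s => ∫ x in (0:ℝ)..1, max (u s x - M) 0 ^ 3) (Ioi 0) := by
    refine antitoneOn_of_hasDerivWithinAt_nonpos (convex_Ioi 0) (f' := d) ?_ ?_ ?_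
    · exact fun r hr => (hd r hr).continuousAt.continuousWithinAt
    · intro r hr
      rw [interior_Ioi] at hr
      exact (hd r hr).hasDerivWithinAt
    · intro r hr
      rw [interior_Ioi] at hr
      exact hd' r hr
  have h1 := hanti (mem_Ioi.2 hs) (mem_Ioi.2 (hs.trans_le hst)) hst
  have h2 : ∫ x in (0:ℝ)..1, max (u s x - M) 0 ^ 3 = 0 := by
    rw [intervalIntegral.integral_congr (g := fun _ => (0:ℝ))]
    · simp
    · intro x hx
      rw [uIcc_of_le zero_le_one] at hx
      have := hM x hx
      simp [max_eq_right (sub_nonpos.2 this)]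
  simp only [h2] at h1
  have c0 := kpp_slice H.1 (mem_Ici.2 (hs.trans_le hst).le)
  simp only at c0
  have hc : ContinuousOn (fun x => max (u t x - M) 0 ^ 3) (Icc 0 1) :=
    (show Continuous fun r : ℝ => max (r - M) 0 ^ 3 by fun_prop).comp_continuousOn c0
  intro x hx
  by_contra! hlt
  have : 0 < ∫ x in (0:ℝ)..1, max (u t x - M) 0 ^ 3 := by
    refine intervalIntegral.integral_pos zero_lt_one hc (fun y _ => by positivity) ⟨x, hx, ?_⟩
    have : 0 < max (u t x - M) 0 := lt_max_of_lt_left (by linarith)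
    positivity
  linarith

/-- The `L²` dissipation, in the form used below. -/
lemma kpp_L2 {α : ℝ} (hα : 1 ≤ α) {u ut ux uxx : ℝ → ℝ → ℝ}
    (H : IsKPPSolution α u ut ux uxx) (hn : KPPNonneg u) {m₀ : ℝ} (hm : 1 ≤ m₀)
    (h0 : ∫ x in (0:ℝ)..1, u 0 x = m₀) {t : ℝ} (ht : 0 < t) :
    ∃ d, HasDerivAt (fun s => ∫ x in (0:ℝ)..1, u s x ^ 2) d t ∧
      d ≤ - 2 * ∫ x in (0:ℝ)..1, ux t x ^ 2 := by
  obtain ⟨d, hd, hd'⟩ := kpp_energy hα H hn hm h0 (φ := fun s => s ^ 2) (φ' := fun s => 2 * s)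
    (φ'' := fun _ => 2) (fun s => by simpa using hasDerivAt_pow 2 s)
    (fun s => by simpa using (hasDerivAt_id s).const_mul 2) continuous_const
    (fun s hs => by positivity) ht
  refine ⟨d, hd, ?_⟩
  rw [intervalIntegral.integral_const_mul] at hd'
  linarith

lemma kpp_sup {α : ℝ} (hα : 1 ≤ α) {u ut ux uxx : ℝ → ℝ → ℝ}
    (H : IsKPPSolution α u ut ux uxx) (hn : KPPNonneg u) {m₀ : ℝ} (hm : 1 ≤ m₀)
    (h0 : ∫ x in (0:ℝ)..1, u 0 x = m₀) {t : ℝ} (ht : 0 < t) :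
    ∀ x ∈ Icc (0:ℝ) 1, u t x ≤ m₀ + √(∫ x in (0:ℝ)..1, ux t x ^ 2) := by
  intro x hx
  have h1 := (kpp_mass hα H hn hm h0 ht).2
  obtain ⟨-, -, hux, -, -, hdx, -⟩ := H
  have := kpp_sobolev (hdx t ht) (kpp_slice hux (mem_Ioi.2 ht)) hx
  linarith

/-- Interpolation in power form. -/
lemma kpp_pow {α : ℝ} (hα : 1 ≤ α) {u ut ux uxx : ℝ → ℝ → ℝ}
    (H : IsKPPSolution α u ut ux uxx) (hn : KPPNonneg u) {m₀ : ℝ} (hm : 1 ≤ m₀)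
    (h0 : ∫ x in (0:ℝ)..1, u 0 x = m₀) {t : ℝ} (ht : 0 < t) {k M : ℝ} (hk : 1 < k)
    (hM0 : 0 ≤ M) (hM : ∀ x ∈ Icc (0:ℝ) 1, u t x ≤ M) :
    ∫ x in (0:ℝ)..1, u t x ^ k ≤ M ^ (k - 1) * m₀ := by
  have h1 := (kpp_mass hα H hn hm h0 ht).2
  have c0 := kpp_slice H.1 (mem_Ici.2 ht.le)
  simp only at c0
  calc ∫ x in (0:ℝ)..1, u t x ^ k ≤ ∫ x in (0:ℝ)..1, M ^ (k - 1) * u t x := by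
        refine intervalIntegral.integral_mono_on zero_le_one
          (kpp_int (c0.rpow_const fun x _ => Or.inr (by linarith)))
          ((kpp_int c0).const_mul _) ?_
        intro x hx
        have hx0 := hn t ht.le x hx
        have : u t x ^ k = u t x ^ (k - 1) * u t x := by
          rw [← rpow_add_one' hx0 (by linarith)]
          congr 1
          ring
        rw [this]
        exact mul_le_mul_of_nonneg_right
          (rpow_le_rpow hx0 (hM x hx) (by linarith)) hx0
    _ = M ^ (k - 1) * ∫ x in (0:ℝ)..1, u t x := intervalIntegral.integral_const_mul _ _
    _ ≤ M ^ (k - 1) * m₀ := mul_le_mul_of_nonneg_left h1 (rpow_nonneg hM0 _)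

lemma kpp_L2_bound {α : ℝ} (hα : 1 ≤ α) {u ut ux uxx : ℝ → ℝ → ℝ}
    (H : IsKPPSolution α u ut ux uxx) (hn : KPPNonneg u) {m₀ : ℝ} (hm : 1 ≤ m₀)
    (h0 : ∫ x in (0:ℝ)..1, u 0 x = m₀) {t : ℝ} (ht : 0 < t) :
    ∫ x in (0:ℝ)..1, u t x ^ 2 ≤ 4 * m₀ ^ 2 * (1 + 1 / t) := by
  have hE : ∀ r, 0 < r → ∃ d, HasDerivAt (fun s => ∫ x in (0:ℝ)..1, u s x ^ 2) d r ∧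
      d ≤ - 2 * ∫ x in (0:ℝ)..1, ux r x ^ 2 := fun r hr => kpp_L2 hα H hn hm h0 hr
  choose! d hd hd' using hE
  have hD : ∀ r, 0 ≤ ∫ x in (0:ℝ)..1, ux r x ^ 2 := fun r =>
    intervalIntegral.integral_nonneg zero_le_one fun x _ => sq_nonneg _
  have hy : ∀ r, 0 < r → ∫ x in (0:ℝ)..1, u r x ^ 2
      ≤ (m₀ + √(∫ x in (0:ℝ)..1, ux r x ^ 2)) * m₀ := by
    intro r hr
    have := kpp_pow hα H hn hm h0 hr (k := 2) (by norm_num)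
      (add_nonneg (by linarith) (sqrt_nonneg _)) (kpp_sup hα H hn hm h0 hr)
    norm_num at this
    exact this
  set y : ℝ → ℝ := fun s => ∫ x in (0:ℝ)..1, u s x ^ 2 with hydef
  have hanti : AntitoneOn y (Ioi 0) := by
    refine antitoneOn_of_hasDerivWithinAt_nonpos (convex_Ioi 0) (f' := d) ?_ ?_ ?_
    · exact fun r hr => (hd r hr).continuousAt.continuousWithinAt
    · intro r hr
      rw [interior_Ioi] at hr
      exact (hd r hr).hasDerivWithinAt
    · intro r hr
      rw [interior_Ioi] at hr
      linarith [hd' r hr, hD r]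
  change y t ≤ _
  by_contra! hlt
  have hm2 : 1 ≤ m₀ ^ 2 := by nlinarith
  have h1t : 0 < 1 / t := by positivity
  have hbig : ∀ r, 0 < r → r ≤ t → 4 * m₀ ^ 2 < y r := by
    intro r hr hrt
    have := hanti (mem_Ioi.2 hr) (mem_Ioi.2 ht) hrt
    nlinarith
  have hd2 : ∀ r, 0 < r → r ≤ t → d r ≤ - (y r ^ 2 / (2 * m₀ ^ 2)) := by
    intro r hr hrt
    have b := hbig r hr hrt
    have b1 := hy r hr
    have b2 := sq_sqrt (hD r)
    have b3 := hd' r hr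
    set q := √(∫ x in (0:ℝ)..1, ux r x ^ 2) with hq
    have hq0 : 0 ≤ q := sqrt_nonneg _
    have b4 : y r ≤ 2 * m₀ * q := by
      have : y r ≤ (m₀ + q) * m₀ := b1
      nlinarith
    have b5 : y r ^ 2 ≤ (2 * m₀ * q) ^ 2 := pow_le_pow_left₀ (by nlinarith) b4 2
    have b6 : y r ^ 2 / (2 * m₀ ^ 2) ≤ 2 * q ^ 2 := by
      rw [div_le_iff₀ (by positivity)]
      nlinarith
    linarith
  have ht2 : t / 2 < t := by linarith
  have hpos : ∀ r ∈ Icc (t/2) t, 0 < r ∧ 0 < y r := by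
    intro r hr
    have hr0 : 0 < r := lt_of_lt_of_le (by positivity) hr.1
    exact ⟨hr0, lt_trans (by positivity) (hbig r hr0 hr.2)⟩
  have hdi : ∀ r ∈ Icc (t/2) t, HasDerivAt (fun s => (y s)⁻¹) (- d r / y r ^ 2) r := fun r hr =>
    (hd r (hpos r hr).1).fun_inv (hpos r hr).2.ne'
  obtain ⟨c, hc, hc'⟩ := exists_hasDerivAt_eq_slope (fun s => (y s)⁻¹) (fun r => - d r / y r ^ 2)
    ht2 (fun r hr => (hdi r hr).continuousAt.continuousWithinAt)
    (fun r hr => hdi r (Ioo_subset_Icc_self hr))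
  have hc2 := Ioo_subset_Icc_self hc
  have hyc := (hpos c hc2).2
  have e1 : 1 / (2 * m₀ ^ 2) ≤ - d c / y c ^ 2 := by
    have := hd2 c (hpos c hc2).1 hc2.2
    rw [le_div_iff₀ (by positivity)]
    have e : 1 / (2 * m₀ ^ 2) * y c ^ 2 = y c ^ 2 / (2 * m₀ ^ 2) := by ring
    linarith
  rw [hc'] at e1
  rw [show t - t / 2 = t / 2 by ring, le_div_iff₀ (by positivity)] at e1
  have e2 : 0 < (y (t/2))⁻¹ := inv_pos.2 (hpos (t/2) ⟨le_rfl, ht2.le⟩).2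
  have e3 : t / (4 * m₀ ^ 2) ≤ (y t)⁻¹ := by
    have : 1 / (2 * m₀ ^ 2) * (t / 2) = t / (4 * m₀ ^ 2) := by
      field_simp
      norm_num
    linarith
  have hyt := (hpos t ⟨ht2.le, le_rfl⟩).2
  have e4 : y t ≤ 4 * m₀ ^ 2 / t := by
    rw [le_inv_comm₀ (by positivity) hyt] at e3
    simpa [inv_div] using e3
  have e5 : 4 * m₀ ^ 2 * (1 + 1 / t) = 4 * m₀ ^ 2 + 4 * m₀ ^ 2 / t := by ring
  nlinarith

lemma kpp_Linf {α : ℝ} (hα : 1 ≤ α) {u ut ux uxx : ℝ → ℝ → ℝ}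
    (H : IsKPPSolution α u ut ux uxx) (hn : KPPNonneg u) {m₀ : ℝ} (hm : 1 ≤ m₀)
    (h0 : ∫ x in (0:ℝ)..1, u 0 x = m₀) {t : ℝ} (ht : 0 < t) :
    ∀ x ∈ Icc (0:ℝ) 1, u t x ≤ 4 * m₀ * (1 + 1 / t) := by
  have hE : ∀ r, 0 < r → ∃ d, HasDerivAt (fun s => ∫ x in (0:ℝ)..1, u s x ^ 2) d r ∧
      d ≤ - 2 * ∫ x in (0:ℝ)..1, ux r x ^ 2 := fun r hr => kpp_L2 hα H hn hm h0 hr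
  choose! d hd hd' using hE
  have ht2 : t / 2 < t := by linarith
  have ht20 : 0 < t / 2 := by linarith
  obtain ⟨c, hc, hc'⟩ := exists_hasDerivAt_eq_slope (fun s => ∫ x in (0:ℝ)..1, u s x ^ 2) d
    ht2 (fun r hr => (hd r (ht20.trans_le hr.1)).continuousAt.continuousWithinAt)
    (fun r hr => hd r (ht20.trans hr.1))
  have hc0 : 0 < c := ht20.trans hc.1
  have h1 := hd' c hc0
  have h2 := kpp_L2_bound hα H hn hm h0 ht20
  have h3 : 0 ≤ ∫ x in (0:ℝ)..1, u t x ^ 2 :=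
    intervalIntegral.integral_nonneg zero_le_one fun x _ => sq_nonneg _
  rw [show t - t / 2 = t / 2 by ring, eq_div_iff (by positivity)] at hc'
  set D := ∫ x in (0:ℝ)..1, ux c x ^ 2 with hDdef
  have h4 : D * t ≤ 4 * m₀ ^ 2 * (1 + 1 / (t / 2)) := by nlinarith
  have hw : 1 / (t / 2) = 2 * (1 / t) := by field_simp
  rw [hw] at h4
  have hw0 : 0 < 1 / t := by positivity
  have hwt : 1 / t * t = 1 := by field_simp
  set w := 1 / t
  have h5 : D ≤ 4 * m₀ ^ 2 * (1 + 2 * w) * w := by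
    calc D = D * t * w := by rw [mul_assoc, mul_comm t w, hwt, mul_one]
      _ ≤ _ := mul_le_mul_of_nonneg_right h4 hw0.le
  have h6 : √D ≤ 2 * m₀ * (1 + 2 * w) := by
    apply Real.sqrt_le_iff.2 ⟨by positivity, h5.trans ?_⟩
    have : 0 ≤ 4 * m₀ ^ 2 * (1 + 2 * w) := by positivity
    nlinarith
  apply kpp_max hα H hn hm h0 hc0 hc.2.le
  intro x hx
  have h7 := kpp_sup hα H hn hm h0 hc0 x hx
  rw [← hDdef] at h7
  nlinarith

/-- **Hyper-contractive `L^k` estimate, supercritical mass (`n = 1`).**  For `k > 1` and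
`m₀ ≥ 1` there is `C = C(m₀,k) > 0` (independent of `α ≥ 1` and of the `L^k` norm of the
initial datum) such that every nonnegative classical solution with initial mass `m₀`
satisfies `∫₀¹ u(t,x)^k dx ≤ C + (C/t)^{k-1}` for all `t > 0`. -/
theorem Lk_hypercontractive_supercritical (k m₀ : ℝ) (hk : 1 < k) (hm₀ : 1 ≤ m₀) :
    ∃ C > (0:ℝ), ∀ α : ℝ, 1 ≤ α → ∀ u ut ux uxx : ℝ → ℝ → ℝ,
      IsKPPSolution α u ut ux uxx → KPPNonneg u →
      (∫ x in (0:ℝ)..1, u 0 x) = m₀ →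
      ∀ t ∈ Ioi (0:ℝ),
        (∫ x in (0:ℝ)..1, u t x ^ k) ≤ C + (C / t) ^ (k - 1) := by
  have hm0 : 0 < m₀ := by linarith
  have hk1 : 0 < k - 1 := by linarith
  set A : ℝ := (8 * m₀) ^ (k - 1) * m₀ with hA
  set B : ℝ := 8 * m₀ * m₀ ^ (1 / (k - 1)) with hB
  have hA0 : 0 < A := by positivity
  have hB0 : 0 < B := by positivity
  refine ⟨A + B, by positivity, ?_⟩
  intro α hα u ut ux uxx H hn h0 t ht
  have ht : 0 < t := ht
  have h1 := kpp_pow hα H hn hm₀ h0 ht hk (by positivity) (kpp_Linf hα H hn hm₀ h0 ht)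
  refine h1.trans ?_
  rcases le_total 1 t with h | h
  · have e1 : 1 / t ≤ 1 := by rw [div_le_one ht]; exact h
    have e2 : (4 * m₀ * (1 + 1 / t)) ^ (k - 1) ≤ (8 * m₀) ^ (k - 1) :=
      rpow_le_rpow (by positivity) (by nlinarith) hk1.le
    have e3 : 0 ≤ ((A + B) / t) ^ (k - 1) := by positivity
    have e4 := mul_le_mul_of_nonneg_right e2 hm0.le
    linarith
  · have e1 : 1 ≤ 1 / t := by rw [le_div_iff₀ ht]; linarith
    have e2 : (4 * m₀ * (1 + 1 / t)) ^ (k - 1) ≤ (8 * m₀ / t) ^ (k - 1) := by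
      refine rpow_le_rpow (by positivity) ?_ hk1.le
      rw [show 8 * m₀ / t = 8 * m₀ * (1 / t) by ring]
      nlinarith
    have e4 := mul_le_mul_of_nonneg_right e2 hm0.le
    have e5 : (8 * m₀ / t) ^ (k - 1) * m₀ = (B / t) ^ (k - 1) := by
      rw [show B / t = 8 * m₀ / t * m₀ ^ (1 / (k - 1)) by rw [hB]; ring,
        mul_rpow (by positivity) (by positivity), ← rpow_mul hm0.le,
        one_div_mul_cancel hk1.ne', rpow_one]
    have e6 : (B / t) ^ (k - 1) ≤ ((A + B) / t) ^ (k - 1) := by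
      refine rpow_le_rpow (by positivity) ?_ hk1.le
      gcongr
      linarith
    linarith
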